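/- Let K be a field. For every matrix m ∈ M₂(K(t)) all four of whose entries lie in K(t)₀, the matrix 1 − t·m is invertible in the ring C_K: there exists w ∈ C_K with (1 − t·m)·w = w·(1 − t·m) = 1. (This is the claim, from the proof of Theorem 9.1, that the ideal J = t·M₂(K(t)₀) consists of quasi-regular elements of C_K.) -/

import Mathlib

/-- `x ∈ K(t)₀`: `x` is expressible as `p/q` with polynomials `p, q` such that
`q(0) ≠ 0`. -/
def InK0 (K : Type*) [Field K] (x : RatFunc K) : Prop :=
  ∃ p q : Polynomial K, q.eval 0 ≠ 0 ∧
    x = algebraMap (Polynomial K) (RatFunc K) p / algebraMap (Polynomial K) (RatFunc K) q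

/-- Membership in `C_K`: the subring of `M₂(K(t))` of matrices whose diagonal entries
lie in `K(t)₀` and whose off-diagonal entries lie in `t·K(t)₀`. -/
def InCK (K : Type*) [Field K] (m : Matrix (Fin 2) (Fin 2) (RatFunc K)) : Prop :=
  (∀ i j, InK0 K (m i j)) ∧
    ∀ i j, i ≠ j → ∃ y : RatFunc K, InK0 K y ∧ m i j = RatFunc.X * y

namespace InK0

variable {K : Type*} [Field K] {x y : RatFunc K}

theorem algebraMap_ne_zero {q : Polynomial K} (hq : q.eval 0 ≠ 0) :
    algebraMap (Polynomial K) (RatFunc K) q ≠ 0 :=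
  RatFunc.algebraMap_ne_zero fun h => hq (by simp [h])

theorem algebraMap (p : Polynomial K) : InK0 K (algebraMap (Polynomial K) (RatFunc K) p) :=
  ⟨p, 1, by simp, by simp⟩

theorem one : InK0 K 1 := by simpa using InK0.algebraMap (1 : Polynomial K)

theorem X : InK0 K RatFunc.X := by simpa using InK0.algebraMap (Polynomial.X : Polynomial K)

theorem mul (hx : InK0 K x) (hy : InK0 K y) : InK0 K (x * y) := by
  obtain ⟨p, q, hq, rfl⟩ := hx
  obtain ⟨r, s, hs, rfl⟩ := hy
  refine ⟨p * r, q * s, by simp [hq, hs], ?_⟩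
  rw [div_mul_div_comm, map_mul, map_mul]

theorem add (hx : InK0 K x) (hy : InK0 K y) : InK0 K (x + y) := by
  obtain ⟨p, q, hq, rfl⟩ := hx
  obtain ⟨r, s, hs, rfl⟩ := hy
  refine ⟨p * s + q * r, q * s, by simp [hq, hs], ?_⟩
  rw [div_add_div _ _ (algebraMap_ne_zero hq) (algebraMap_ne_zero hs), map_add, map_mul, map_mul,
    map_mul]

theorem neg (hx : InK0 K x) : InK0 K (-x) := by
  obtain ⟨p, q, hq, rfl⟩ := hx
  exact ⟨-p, q, hq, by rw [map_neg, neg_div]⟩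

theorem sub (hx : InK0 K x) (hy : InK0 K y) : InK0 K (x - y) :=
  sub_eq_add_neg x y ▸ hx.add hy.neg

theorem exists_mul_eq_one (hx : InK0 K x) : ∃ u, InK0 K u ∧ (1 - RatFunc.X * x) * u = 1 := by
  obtain ⟨p, q, hq, rfl⟩ := hx
  have hr : (q - Polynomial.X * p).eval 0 ≠ 0 := by simpa using hq
  refine ⟨_, ⟨q, q - Polynomial.X * p, hr, rfl⟩, ?_⟩
  have hr' := algebraMap_ne_zero hr
  have hq' := algebraMap_ne_zero hq
  rw [map_sub, map_mul, RatFunc.algebraMap_X] at hr' ⊢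
  field_simp

end InK0

set_option synthInstance.maxHeartbeats 1000000 in
/-- **Claim from the proof of Theorem 9.1**: the ideal `J = t·M₂(K(t)₀)` consists of
quasi-regular elements of `C_K`. For every matrix `m ∈ M₂(K(t))` all of whose entries
lie in `K(t)₀`, the matrix `1 − t·m` is invertible in `C_K`. -/
theorem stmt8 {K : Type*} [Field K] (m : Matrix (Fin 2) (Fin 2) (RatFunc K))
    (hm : ∀ i j, InK0 K (m i j)) :
    ∃ w : Matrix (Fin 2) (Fin 2) (RatFunc K), InCK K w ∧
      (1 - (RatFunc.X : RatFunc K) • m) * w = 1 ∧ w * (1 - (RatFunc.X : RatFunc K) • m) = 1 := by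
  have ht : InK0 K (m 0 0 + m 1 1 - RatFunc.X * (m 0 0 * m 1 1 - m 0 1 * m 1 0)) :=
    ((hm 0 0).add (hm 1 1)).sub
      (InK0.X.mul (((hm 0 0).mul (hm 1 1)).sub ((hm 0 1).mul (hm 1 0))))
  obtain ⟨u, hu, h⟩ := ht.exists_mul_eq_one
  have hw : (1 - (RatFunc.X : RatFunc K) • m) *
      !![(1 - RatFunc.X * m 1 1) * u, RatFunc.X * (m 0 1 * u);
        RatFunc.X * (m 1 0 * u), (1 - RatFunc.X * m 0 0) * u] = 1 := by
    ext i j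
    fin_cases i <;> fin_cases j <;>
      simp only [Matrix.mul_apply, Fin.sum_univ_two, Matrix.sub_apply, Matrix.smul_apply,
        smul_eq_mul, Matrix.one_apply, Matrix.of_apply, Matrix.cons_val', Matrix.cons_val_zero,
        Matrix.cons_val_one, Matrix.cons_val_fin_one, Fin.zero_eta, Fin.mk_one, Fin.isValue,
        zero_ne_one, one_ne_zero, if_true, if_false]
    · linear_combination h
    · ring
    · ring
    · linear_combination h
  refine ⟨_, ⟨?_, ?_⟩, hw, mul_eq_one_comm.mp hw⟩
  · intro i j
    fin_cases i <;> fin_cases j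
    · exact (InK0.one.sub (InK0.X.mul (hm 1 1))).mul hu
    · exact InK0.X.mul ((hm 0 1).mul hu)
    · exact InK0.X.mul ((hm 1 0).mul hu)
    · exact (InK0.one.sub (InK0.X.mul (hm 0 0))).mul hu
  · intro i j hij
    fin_cases i <;> fin_cases j
    · exact absurd rfl hij
    · exact ⟨_, (hm 0 1).mul hu, rfl⟩
    · exact ⟨_, (hm 1 0).mul hu, rfl⟩
    · exact absurd rfl hij
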